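/- arXiv:2601.15881 — 3 statements merged into one kernel-verified Lean document; each statement's English description precedes it below -/
import Mathlib

section
/- Let n ≥ 1, let e_1,…,e_n be the canonical orthonormal basis of ℝ^n, let f_1,…,f_n ∈ ℝ^n, set M := max_{i=1,…,n} ‖f_i − e_i‖, and assume nM² < 1. Then every matrix A ∈ ℝ^{n×n} satisfies ‖A‖_F ≤ (√(2n(1+nM²)) / (1 − nM²)) · max_{i=1,…,n} ‖A f_i‖. -/
open scoped BigOperators

/-- Euclidean norm on `ℝ^n`. -/
noncomputable def enorm {n : ℕ} (v : Fin n → ℝ) : ℝ :=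
  Real.sqrt (∑ i, (v i) ^ 2)

/-- Frobenius norm on `n × n` real matrices. -/
noncomputable def fnorm {n : ℕ} (A : Matrix (Fin n) (Fin n) ℝ) : ℝ :=
  Real.sqrt (∑ i, ∑ j, (A i j) ^ 2)

/-- Maximum of a real-valued function over a nonempty finite type. -/
noncomputable def fmax {α : Type*} [Fintype α] (h : Nonempty α) (g : α → ℝ) : ℝ :=
  Finset.univ.sup' (Finset.univ_nonempty_iff.mpr h) g

section FrobeniusNorm

open scoped Matrix.Norms.Frobenius

variable {n : ℕ}

theorem fnorm_eq_frobenius_norm (A : Matrix (Fin n) (Fin n) ℝ) : fnorm A = ‖A‖ := by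
  rw [Matrix.frobenius_norm_def, fnorm, Real.sqrt_eq_rpow]
  simp

theorem fnorm_mul_le (A B : Matrix (Fin n) (Fin n) ℝ) : fnorm (A * B) ≤ fnorm A * fnorm B := by
  simpa only [fnorm_eq_frobenius_norm] using Matrix.frobenius_norm_mul A B

theorem fnorm_sub_le (A B : Matrix (Fin n) (Fin n) ℝ) : fnorm (A - B) ≤ fnorm A + fnorm B := by
  simpa only [fnorm_eq_frobenius_norm] using norm_sub_le A B

end FrobeniusNorm

/-- A matrix all of whose columns have Euclidean norm at most `c` has Frobenius norm at most
`√n * c`. -/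
theorem fnorm_le_sqrt_mul_of_col_le {n : ℕ} {B : Matrix (Fin n) (Fin n) ℝ} {c : ℝ} (hc : 0 ≤ c)
    (hB : ∀ j, Real.sqrt (∑ i, (B i j) ^ 2) ≤ c) : fnorm B ≤ Real.sqrt n * c := by
  rw [fnorm, Finset.sum_comm]
  have hcol : ∑ j, ∑ i, (B i j) ^ 2 ≤ n * c ^ 2 := by
    calc ∑ j, ∑ i, (B i j) ^ 2 ≤ ∑ _j : Fin n, c ^ 2 :=
          Finset.sum_le_sum fun j _ => (Real.sqrt_le_left hc).1 (hB j)
      _ = n * c ^ 2 := by simp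
  calc Real.sqrt (∑ j, ∑ i, (B i j) ^ 2) ≤ Real.sqrt (n * c ^ 2) := Real.sqrt_le_sqrt hcol
    _ = Real.sqrt n * c := by rw [Real.sqrt_mul (Nat.cast_nonneg n), Real.sqrt_sq hc]

theorem le_fmax {α : Type*} [Fintype α] (h : Nonempty α) (g : α → ℝ) (a : α) :
    g a ≤ fmax h g :=
  Finset.le_sup' g (Finset.mem_univ a)

/-- Quantitative version of Lemma 4.2 (estimate (4.5) in the proof of Theorem 2.3). -/
theorem frobenius_norm_le_of_perturbed_basis
    (n : ℕ) (hn : 1 ≤ n) (f : Fin n → (Fin n → ℝ)) (M : ℝ)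
    (hM : M = fmax (Fin.pos_iff_nonempty.mp hn) (fun i => enorm (f i - Pi.single i 1)))
    (hnM : (n : ℝ) * M ^ 2 < 1)
    (A : Matrix (Fin n) (Fin n) ℝ) :
    fnorm A ≤ Real.sqrt (2 * n * (1 + n * M ^ 2)) / (1 - n * M ^ 2) *
      fmax (Fin.pos_iff_nonempty.mp hn) (fun i => enorm (A.mulVec (f i))) := by
  have hne := Fin.pos_iff_nonempty.mp hn
  set m := fmax (Fin.pos_iff_nonempty.mp hn) (fun i => enorm (A.mulVec (f i)))
  have hMle : ∀ i, Real.sqrt (∑ k, ((f i - Pi.single i 1 : Fin n → ℝ) k) ^ 2) ≤ M := fun i => by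
    rw [hM]; exact le_fmax hne (fun i => enorm (f i - Pi.single i 1)) i
  have hmle : ∀ i, Real.sqrt (∑ k, (A.mulVec (f i) k) ^ 2) ≤ m := fun i =>
    le_fmax hne (fun i => enorm (A.mulVec (f i))) i
  have hM0 : 0 ≤ M := (Real.sqrt_nonneg _).trans (hMle hne.some)
  have hm0 : 0 ≤ m := (Real.sqrt_nonneg _).trans (hmle hne.some)
  let F : Matrix (Fin n) (Fin n) ℝ := Matrix.of fun k i => f i k
  have hE : fnorm (F - 1) ≤ Real.sqrt n * M := fnorm_le_sqrt_mul_of_col_le hM0 fun i => by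
    convert hMle i using 5 with k
    simp [F, Matrix.one_apply, Pi.single_apply]
  have hAF : fnorm (A * F) ≤ Real.sqrt n * m := fnorm_le_sqrt_mul_of_col_le hm0 hmle
  have hA0 : 0 ≤ fnorm A := Real.sqrt_nonneg _
  have hA : fnorm A ≤ Real.sqrt n * m + fnorm A * (Real.sqrt n * M) := by
    calc fnorm A = fnorm (A * F - A * (F - 1)) := by simp [mul_sub]
      _ ≤ fnorm (A * F) + fnorm (A * (F - 1)) := fnorm_sub_le _ _
      _ ≤ fnorm (A * F) + fnorm A * fnorm (F - 1) := by gcongr; exact fnorm_mul_le _ _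
      _ ≤ _ := by gcongr
  have hsq : (Real.sqrt n * M) ^ 2 = n * M ^ 2 := by
    rw [mul_pow, Real.sq_sqrt (Nat.cast_nonneg n)]
  set t := Real.sqrt n * M
  have ht0 : 0 ≤ t := by positivity
  rw [← hsq] at hnM ⊢
  have hroot : Real.sqrt n * (1 + t) ≤ Real.sqrt (2 * n * (1 + t ^ 2)) := by
    apply Real.le_sqrt_of_sq_le
    rw [mul_pow, Real.sq_sqrt (Nat.cast_nonneg n)]
    nlinarith [mul_nonneg (Nat.cast_nonneg (α := ℝ) n) (sq_nonneg (1 - t))]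
  rw [div_mul_eq_mul_div, le_div_iff₀ (by linarith)]
  calc fnorm A * (1 - t ^ 2) = fnorm A * (1 - t) * (1 + t) := by ring
    _ ≤ Real.sqrt n * m * (1 + t) :=
        mul_le_mul_of_nonneg_right (by linarith) (by linarith)
    _ = Real.sqrt n * (1 + t) * m := by ring
    _ ≤ _ := by gcongr
end

section
/- Let m > 0, θ ≥ 0, β ≥ 0 and ν_k, ν_l, s₁, s₂ ∈ ℝ satisfy ν_k ν_l < 0, |ν_k| > |ν_l|, |s₁| ≤ (m+θ)|ν_l| and |s₂ − β ν_k| ≤ (m+θ)|ν_l|. Then the determinant of the 2×2 matrix with first row (m ν_k, 2(m+θ) ν_k + s₁) and second row (m ν_l, −2θ ν_l + s₂) is strictly positive; in particular, the only x = (x₁,x₂) ∈ ℝ² with m ν_k x₁ + (2(m+θ) ν_k + s₁) x₂ = 0 and m ν_l x₁ + (−2θ ν_l + s₂) x₂ = 0 is x = (0,0). -/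
open scoped BigOperators


/-- Step 2 of the proof of Theorem 2.9: determinant positivity when the two
distinguished components of the normal vector have different signs. -/
theorem det_pos_of_opposite_signs
    (m θ β νk νl s1 s2 : ℝ)
    (hm : 0 < m) (hθ : 0 ≤ θ) (hβ : 0 ≤ β)
    (hsign : νk * νl < 0) (hgt : |νl| < |νk|)
    (hs1 : |s1| ≤ (m + θ) * |νl|)
    (hs2 : |s2 - β * νk| ≤ (m + θ) * |νl|) :
    0 < Matrix.det !![m * νk, 2 * (m + θ) * νk + s1; m * νl, -2 * θ * νl + s2] ∧
    ∀ x1 x2 : ℝ,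
      m * νk * x1 + (2 * (m + θ) * νk + s1) * x2 = 0 →
      m * νl * x1 + (-2 * θ * νl + s2) * x2 = 0 →
      x1 = 0 ∧ x2 = 0 := by
  have hprod : |νk| * |νl| = -(νk * νl) := by rw [← abs_mul, abs_of_neg hsign]
  have hνk : νk ≠ 0 := left_ne_zero_of_mul hsign.ne
  have hνl : 0 < |νl| := abs_pos.mpr (right_ne_zero_of_mul hsign.ne)
  have hk : -(νk * (s2 - β * νk)) ≤ (m + θ) * (|νk| * |νl|) := by
    calc -(νk * (s2 - β * νk)) ≤ |νk * (s2 - β * νk)| := neg_le_abs _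
      _ = |νk| * |s2 - β * νk| := abs_mul _ _
      _ ≤ |νk| * ((m + θ) * |νl|) := by gcongr
      _ = (m + θ) * (|νk| * |νl|) := by ring
  have hl : νl * s1 < (m + θ) * (|νk| * |νl|) := by
    calc νl * s1 ≤ |νl * s1| := le_abs_self _
      _ = |νl| * |s1| := abs_mul _ _
      _ ≤ |νl| * ((m + θ) * |νl|) := by gcongr
      _ = (m + θ) * (|νl| * |νl|) := by ring
      _ < (m + θ) * (|νk| * |νl|) := by gcongr
  have hdet : 0 < νk * (-2 * θ * νl + s2) - (2 * (m + θ) * νk + s1) * νl := by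
    rw [hprod] at hk hl
    have hβk : 0 ≤ β * νk ^ 2 := by positivity
    have hθkl : 0 ≤ θ * -(νk * νl) := mul_nonneg hθ (neg_nonneg.mpr hsign.le)
    linarith
  refine ⟨?_, fun x1 x2 h1 h2 => ?_⟩
  · rw [Matrix.det_fin_two_of]
    linarith [mul_pos hm hdet]
  · have hx2 : x2 = 0 := by
      refine (mul_eq_zero.mp ?_).resolve_left hdet.ne'
      linear_combination νk * h2 - νl * h1
    subst hx2
    refine ⟨?_, rfl⟩
    simpa [hm.ne', hνk] using h1
end

section
/- Let m > 0, θ ≥ 0, β ≥ 0 and ν_k, ν_l, s₁, s₂ ∈ ℝ satisfy ν_k ν_l > 0, |ν_l| > |ν_k| > 0, |s₁| ≤ (m+θ)|ν_k| and |s₂ + β ν_k| ≤ (m+θ)|ν_k|. Then the determinant of the 2×2 matrix with first row (m ν_k, −2θ ν_k + s₂) and second row (m ν_l, 2(m+θ) ν_l + s₁) is strictly positive; in particular, the only x = (x₁,x₂) ∈ ℝ² solving the corresponding homogeneous 2×2 linear system is x = (0,0). -/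
open scoped BigOperators


/-- Step 3 of the proof of Theorem 2.9: determinant positivity when the two
distinguished components of the normal vector have the same sign. -/
theorem det_pos_of_same_signs
    (m θ β νk νl s1 s2 : ℝ)
    (hm : 0 < m) (hθ : 0 ≤ θ) (hβ : 0 ≤ β)
    (hsign : 0 < νk * νl) (hk0 : 0 < |νk|) (hgt : |νk| < |νl|)
    (hs1 : |s1| ≤ (m + θ) * |νk|)
    (hs2 : |s2 + β * νk| ≤ (m + θ) * |νk|) :
    0 < Matrix.det !![m * νk, -2 * θ * νk + s2; m * νl, 2 * (m + θ) * νl + s1] ∧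
    ∀ x1 x2 : ℝ,
      m * νk * x1 + (-2 * θ * νk + s2) * x2 = 0 →
      m * νl * x1 + (2 * (m + θ) * νl + s1) * x2 = 0 →
      x1 = 0 ∧ x2 = 0 := by
  have hprod : |νk| * |νl| = νk * νl := by rw [← abs_mul, abs_of_pos hsign]
  have hmθ : 0 < m + θ := by linarith
  have h1 : -((m + θ) * (νk * νl)) < νk * s1 := by
    have hle : |νk * s1| ≤ |νk| * ((m + θ) * |νk|) := by
      rw [abs_mul]
      exact mul_le_mul_of_nonneg_left hs1 hk0.le
    have hlt : (m + θ) * (|νk| * |νk|) < (m + θ) * (|νk| * |νl|) := by gcongr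
    rw [hprod] at hlt
    linarith [neg_abs_le (νk * s1)]
  have h2 : νl * (s2 + β * νk) ≤ (m + θ) * (νk * νl) := by
    have hle : |νl * (s2 + β * νk)| ≤ |νl| * ((m + θ) * |νk|) := by
      rw [abs_mul]
      exact mul_le_mul_of_nonneg_left hs2 (abs_nonneg νl)
    rw [← hprod]
    linarith [le_abs_self (νl * (s2 + β * νk))]
  have hpos : 0 < m * νk * (2 * (m + θ) * νl + s1) - (-2 * θ * νk + s2) * (m * νl) := by
    have hθk : 0 ≤ θ * (νk * νl) := mul_nonneg hθ hsign.le
    have hβk : 0 ≤ β * (νk * νl) := mul_nonneg hβ hsign.le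
    have hfac : 0 < νk * (2 * (m + θ) * νl + s1) - (-2 * θ * νk + s2) * νl := by
      linarith
    linarith [mul_pos hm hfac]
  refine ⟨by rwa [Matrix.det_fin_two_of], fun x1 x2 e1 e2 => ?_⟩
  have hx2 : x2 = 0 := by
    refine (mul_eq_zero.mp ?_).resolve_left hpos.ne'
    linear_combination m * νk * e2 - m * νl * e1
  subst hx2
  have hx1 : m * νk * x1 = 0 := by simpa using e1
  exact ⟨(mul_eq_zero.mp hx1).resolve_left (mul_ne_zero hm.ne' (abs_pos.mp hk0)), rfl⟩
end
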